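/- Assume r > 1, 0 < v < (r−1)/2, and set m = 2(2v/(r−1))ⁿ. Let π : (ℝⁿ)^N → ℝ^{1×n} be any measurable map, and let 0 < δ < 1/2. If both P₁({x ∈ (ℝⁿ)^N : A + B₁ π(x) is stable}) ≥ 1−δ and P₂({x ∈ (ℝⁿ)^N : A + B₂ π(x) is stable}) ≥ 1−δ, then N ≥ (σ_w²/(2σ_u²)) · ((r−1)/(2v))^{2n} · log(1/(3δ)). -/

import Mathlib

open Matrix Polynomial MeasureTheory ProbabilityTheory
open scoped ENNReal NNReal

noncomputable section

/-- The state matrix `A`: `A₁,₁ = r`, superdiagonal entries `v`, all else `0`. -/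
def matA (n : ℕ) (r v : ℝ) : Matrix (Fin n) (Fin n) ℝ :=
  Matrix.of fun i j => if (i : ℕ) = 0 ∧ (j : ℕ) = 0 then r
    else if (j : ℕ) = (i : ℕ) + 1 then v else 0

/-- The input vector `B(b)`: first entry `b`, last entry `v`, all else `0`. -/
def vecB (n : ℕ) (v b : ℝ) : Fin n → ℝ :=
  fun i => if (i : ℕ) = 0 then b else if (i : ℕ) = n - 1 then v else 0

/-- A real square matrix is stable if every complex eigenvalue (root of its
characteristic polynomial) has modulus strictly less than `1`. -/
def IsStable {n : ℕ} (M : Matrix (Fin n) (Fin n) ℝ) : Prop :=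
  ∀ z : ℂ, ((Matrix.charpoly M).map (algebraMap ℝ ℂ)).IsRoot z → ‖z‖ < 1

/-- The state trajectory: `x₀ = 0`, `x_{t+1} = A x_t + B u_t + w_t`. -/
def traj {n : ℕ} (A : Matrix (Fin n) (Fin n) ℝ) (B : Fin n → ℝ) (u : ℕ → ℝ)
    (w : ℕ → Fin n → ℝ) : ℕ → Fin n → ℝ
  | 0 => 0
  | t + 1 => A *ᵥ traj A B u w t + u t • B + w t

/-- The map `T_{(A,B)}` sending the noise sequence `(w₀, …, w_{N-1})` to the state
trajectory `(x₁, …, x_N)`. -/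
def trajMap {n : ℕ} (N : ℕ) (A : Matrix (Fin n) (Fin n) ℝ) (B : Fin n → ℝ)
    (u : ℕ → ℝ) : (Fin N → Fin n → ℝ) → (Fin N → Fin n → ℝ) :=
  fun w t => traj A B u (fun s => if h : s < N then w ⟨s, h⟩ else 0) ((t : ℕ) + 1)

theorem msum_aux (s : Multiset ℂ) (h : ∀ z ∈ s, ‖z‖ < 1) : ‖s.sum‖ ≤ s.card := by
  induction s using Multiset.induction with
  | empty => simp
  | cons a s ih =>
    have h1 := ih (fun z hz => h z (Multiset.mem_cons_of_mem hz))
    have h2 := h a (Multiset.mem_cons_self a s)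
    simp only [Multiset.sum_cons, Multiset.card_cons, Nat.cast_add, Nat.cast_one]
    linarith [norm_add_le a s.sum]

theorem mprod_aux (r : ℝ) (hr : 1 < r) (s : Multiset ℂ) (h : ∀ z ∈ s, ‖z‖ < 1) :
    (r - 1) ^ s.card ≤ ‖(s.map (fun z => (r : ℂ) - z)).prod‖ := by
  induction s using Multiset.induction with
  | empty => simp
  | cons a s ih =>
    have h1 := ih (fun z hz => h z (Multiset.mem_cons_of_mem hz))
    have h2 := h a (Multiset.mem_cons_self a s)
    simp only [Multiset.map_cons, Multiset.prod_cons, Multiset.card_cons, norm_mul, pow_succ']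
    have h3 : r - 1 ≤ ‖(r : ℂ) - a‖ := by
      have := norm_sub_norm_le (r : ℂ) a
      rw [Complex.norm_of_nonneg (by linarith)] at this
      linarith
    have h4 : 0 ≤ r - 1 := by linarith
    gcongr

theorem roots_aux {n : ℕ} (M : Matrix (Fin n) (Fin n) ℝ) (h : IsStable M) :
    ∀ z ∈ (M.map (algebraMap ℝ ℂ)).charpoly.roots, ‖z‖ < 1 := by
  intro z hz
  apply h z
  rw [← Matrix.charpoly_map]
  exact Polynomial.isRoot_of_mem_roots hz

theorem card_aux {n : ℕ} (M : Matrix (Fin n) (Fin n) ℂ) : M.charpoly.roots.card = n := by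
  rw [← (IsAlgClosed.splits M.charpoly).natDegree_eq_card_roots]
  simp

theorem stable_trace {n : ℕ} (M : Matrix (Fin n) (Fin n) ℝ) (h : IsStable M) :
    |M.trace| ≤ n := by
  have h1 := msum_aux _ (roots_aux M h)
  rw [← Matrix.trace_eq_sum_roots_charpoly, card_aux] at h1
  have h2 : (M.map (algebraMap ℝ ℂ)).trace = ((M.trace : ℝ) : ℂ) := by
    simp [Matrix.trace]
  rw [h2, Complex.norm_real] at h1
  exact h1

theorem stable_eval {n : ℕ} (M : Matrix (Fin n) (Fin n) ℝ) (h : IsStable M) (r : ℝ)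
    (hr : 1 < r) : (r - 1) ^ n ≤ |M.charpoly.eval r| := by
  have h1 := mprod_aux r hr _ (roots_aux M h)
  rw [← (IsAlgClosed.splits _).eval_eq_prod_roots_of_monic (Matrix.charpoly_monic _), card_aux,
    Matrix.charpoly_map] at h1
  have h2 : Polynomial.eval (r : ℂ) (M.charpoly.map (algebraMap ℝ ℂ)) =
      ((M.charpoly.eval r : ℝ) : ℂ) := by
    exact Polynomial.eval_map_apply (algebraMap ℝ ℂ) r
  rw [h2, Complex.norm_real] at h1
  exact h1

theorem entry_aux (k : ℕ) (r v : ℝ) (K : Fin (k + 2) → ℝ) (i j : Fin (k + 2)) :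
    (Matrix.scalar (Fin (k + 2)) r -
      (matA (k + 2) r v + Matrix.vecMulVec (vecB (k + 2) v 0) K)) i j =
    (if (i : ℕ) = j then r else 0) - ((if (i : ℕ) = 0 ∧ (j : ℕ) = 0 then r
      else if (j : ℕ) = (i : ℕ) + 1 then v else 0) +
      (if (i : ℕ) = 0 then 0 else if (i : ℕ) = k + 1 then v else 0) * K j) := by
  simp only [Matrix.sub_apply, Matrix.add_apply, Matrix.scalar_apply, Matrix.diagonal_apply,
    Fin.ext_iff, Matrix.vecMulVec_apply, matA, vecB, Matrix.of_apply]
  rfl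

theorem eval_aux (k : ℕ) (r v : ℝ) (K : Fin (k + 2) → ℝ) :
    (matA (k + 2) r v + Matrix.vecMulVec (vecB (k + 2) v 0) K).charpoly.eval r
      = - K 0 * v ^ (k + 2) := by
  rw [Matrix.eval_charpoly, Matrix.det_succ_column_zero, Finset.sum_eq_single (Fin.last (k + 1))]
  · have h1 : (Matrix.submatrix (Matrix.scalar (Fin (k + 2)) r -
        (matA (k + 2) r v + Matrix.vecMulVec (vecB (k + 2) v 0) K)) (Fin.last (k + 1)).succAbove
          Fin.succ).det = (-v) ^ (k + 1) := by
      rw [Matrix.det_of_isLowerTriangular]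
      · rw [Finset.prod_congr rfl (g := fun _ => -v)]
        · simp
        · intro i _
          have := i.2
          rw [Matrix.submatrix_apply, entry_aux, Fin.succAbove_last, Fin.val_castSucc,
            Fin.val_succ, if_neg (by omega), if_neg (by omega), if_pos rfl,
            if_neg (c := (i : ℕ) = k + 1) (by omega)]
          simp
      · intro i j hij
        have hij : i < j := by simpa using hij
        rw [Fin.lt_def] at hij
        have := i.2
        have := j.2
        rw [Matrix.submatrix_apply, entry_aux, Fin.succAbove_last, Fin.val_castSucc,
            Fin.val_succ, if_neg (by omega), if_neg (by omega), if_neg (by omega),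
            if_neg (c := (i : ℕ) = k + 1) (by omega)]
        simp
    rw [h1, entry_aux]
    have e1 : ((Fin.last (k + 1) : Fin (k + 2)) : ℕ) = k + 1 := rfl
    have e2 : ((0 : Fin (k + 2)) : ℕ) = 0 := rfl
    rw [if_neg (by omega), if_neg (by omega), if_neg (by omega), if_neg (by omega), if_pos e1, e1]
    have : ((-1:ℝ)) ^ (k+1) * (-1) ^ (k+1) = 1 := by rw [← mul_pow]; simp
    rw [neg_pow v]
    linear_combination (-K 0 * v ^ (k+2)) * this
  · intro b _ hb
    have h2 : (b : ℕ) ≠ k + 1 := fun h => hb (Fin.ext h)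
    rw [entry_aux]
    by_cases h0 : (b : ℕ) = 0 <;> simp [h0, h2]
  · simp

theorem trace_aux (k : ℕ) (r v b : ℝ) (K : Fin (k + 2) → ℝ) :
    (matA (k + 2) r v + Matrix.vecMulVec (vecB (k + 2) v b) K).trace
      = r + b * K 0 + v * K (Fin.last (k + 1)) := by
  rw [Matrix.trace_add, Matrix.trace_vecMulVec]
  have h1 : (matA (k + 2) r v).trace = r := by
    simp [Matrix.trace, matA]
  rw [h1]
  simp only [dotProduct]
  rw [Fin.sum_univ_succ, Fin.sum_univ_castSucc]
  have : ∀ i : Fin k, (i : ℕ) ≠ k := fun i => i.2.ne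
  simp [vecB, this]
  ring

theorem disj_aux (n : ℕ) (hn : 2 ≤ n) (r v : ℝ) (hr : 1 < r) (hv0 : 0 < v) :
    ∃ C : Set (Fin n → ℝ), MeasurableSet C ∧
      (∀ K, IsStable (matA n r v + Matrix.vecMulVec (vecB n v 0) K) → K ∈ C) ∧
      (∀ K, IsStable (matA n r v +
          Matrix.vecMulVec (vecB n v (2 * (2 * v / (r - 1)) ^ n)) K) → K ∉ C) := by
  obtain ⟨k, rfl⟩ : ∃ k, n = k + 2 := ⟨n - 2, by omega⟩
  refine ⟨{K | (r - 1) ^ (k + 2) ≤ |K 0| * v ^ (k + 2) ∧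
    |r + v * K (Fin.last (k + 1))| ≤ ((k + 2 : ℕ) : ℝ)}, ?_, ?_, ?_⟩
  · apply MeasurableSet.inter
    · exact measurableSet_le (f := fun _ : Fin (k + 2) → ℝ => (r - 1) ^ (k + 2))
        (g := fun K : Fin (k + 2) → ℝ => |K 0| * v ^ (k + 2)) (by fun_prop) (by fun_prop)
    · exact measurableSet_le (f := fun K : Fin (k + 2) → ℝ => |r + v * K (Fin.last (k + 1))|)
        (g := fun _ : Fin (k + 2) → ℝ => ((k + 2 : ℕ) : ℝ)) (by fun_prop) (by fun_prop)
  · intro K hK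
    have h1 := stable_eval _ hK r hr
    have h2 := stable_trace _ hK
    rw [eval_aux, abs_mul, abs_neg, abs_of_pos (pow_pos hv0 (k + 2))] at h1
    rw [trace_aux] at h2
    refine ⟨h1, ?_⟩
    simpa using h2
  · rintro K hK ⟨h1, h3⟩
    have h2 := stable_trace _ hK
    rw [trace_aux] at h2
    have h4 : |2 * (2 * v / (r - 1)) ^ (k + 2) * K 0| ≤ 2 * ((k + 2 : ℕ) : ℝ) := by
      rw [abs_le] at *
      constructor <;> linarith
    have hr' : 0 < r - 1 := by linarith
    have hd : 0 < 2 * v / (r - 1) := by positivity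
    rw [abs_mul, abs_of_pos (by positivity)] at h4
    have h5 : 2 * (2:ℝ) ^ (k + 2) ≤ 2 * (2 * v / (r - 1)) ^ (k + 2) * |K 0| := by
      rw [div_pow, mul_pow]
      have : (2:ℝ) ^ (k + 2) ≤ 2 ^ (k + 2) * v ^ (k + 2) / (r - 1) ^ (k + 2) * |K 0| := by
        rw [div_mul_eq_mul_div, le_div_iff₀ (by positivity), mul_assoc]
        gcongr
        linarith
      linarith
    have h6 : ((k + 2 : ℕ) : ℝ) < 2 ^ (k + 2) := by
      exact_mod_cast Nat.lt_two_pow_self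
    linarith

theorem pi_dens {ι : Type*} [Fintype ι] {X : ι → Type*} [∀ i, MeasurableSpace (X i)]
    (μ ν : ∀ i, Measure (X i)) [∀ i, IsProbabilityMeasure (μ i)]
    [∀ i, IsProbabilityMeasure (ν i)]
    (f : ∀ i, X i → ℝ≥0∞) (hf : ∀ i, Measurable (f i)) (h : ∀ i, ν i = (μ i).withDensity (f i)) :
    Measure.pi ν = (Measure.pi μ).withDensity (fun x => ∏ i, f i (x i)) := by
  apply Measure.pi_eq
  intro s hs
  rw [withDensity_apply _ (MeasurableSet.univ_pi hs), ← lintegral_indicator (MeasurableSet.univ_pi hs)]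
  have h1 : (Set.univ.pi s).indicator (fun x => ∏ i, f i (x i)) =
      fun x => ∏ i, ((s i).indicator (f i)) (x i) := by
    funext x
    by_cases hx : x ∈ Set.univ.pi s
    · rw [Set.indicator_of_mem hx]
      refine Finset.prod_congr rfl fun i _ => ?_
      rw [Set.indicator_of_mem (hx i (Set.mem_univ i))]
    · rw [Set.indicator_of_notMem hx]
      have : ∃ i, x i ∉ s i := by simpa [Set.mem_pi] using hx
      obtain ⟨i, hi⟩ := this
      symm
      apply Finset.prod_eq_zero (Finset.mem_univ i)
      rw [Set.indicator_of_notMem hi]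
  rw [h1]
  have hm : ∀ i, Measurable ((s i).indicator (f i)) := fun i => (hf i).indicator (hs i)
  rw [lintegral_prod_eq_prod_lintegral_of_indepFun Finset.univ
    (fun i (x : ∀ i, X i) => (s i).indicator (f i) (x i))
    (iIndepFun_pi (X := fun i => (s i).indicator (f i)) fun i => (hm i).aemeasurable)
    (fun i => (hm i).comp (measurable_pi_apply i))]
  refine Finset.prod_congr rfl fun i _ => ?_
  rw [h i, withDensity_apply _ (hs i), ← lintegral_indicator (hs i)]
  exact (measurePreserving_eval μ i).lintegral_comp (hm i)

theorem gauss_dens (c : ℝ) (V : ℝ≥0) (hV : V ≠ 0) :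
    gaussianReal c V = (gaussianReal 0 V).withDensity
      (fun x => ENNReal.ofReal (Real.exp ((c * x - c ^ 2 / 2) / V))) := by
  rw [gaussianReal_of_var_ne_zero _ hV, gaussianReal_of_var_ne_zero _ hV,
    ← withDensity_mul _ (measurable_gaussianPDF 0 V) (by fun_prop)]
  congr 1
  funext x
  simp only [Pi.mul_apply, gaussianPDF]
  rw [← ENNReal.ofReal_mul (gaussianPDFReal_nonneg _ _ _), gaussianPDFReal_def, gaussianPDFReal_def]
  congr 1
  beta_reduce
  rw [mul_assoc (_)⁻¹, ← Real.exp_add]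
  have : (V : ℝ) ≠ 0 := by exact_mod_cast hV
  congr 2
  field_simp
  ring

theorem shift_dens (N n : ℕ) (V : ℝ≥0) (hV : V ≠ 0) (c : Fin N → Fin n → ℝ) :
    (Measure.pi fun _ : Fin N => Measure.pi fun _ : Fin n => gaussianReal 0 V).map (fun w => w + c)
    = (Measure.pi fun _ : Fin N => Measure.pi fun _ : Fin n => gaussianReal 0 V).withDensity
      (fun w => ENNReal.ofReal (Real.exp (∑ t, ∑ i, (c t i * w t i - c t i ^ 2 / 2) / V))) := by
  have h1 : ∀ t, (Measure.pi fun _ : Fin n => gaussianReal 0 V).map (fun w => w + c t) =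
      (Measure.pi fun i : Fin n => gaussianReal (c t i) V) := by
    intro t
    have := Measure.pi_map_pi (μ := fun _ : Fin n => gaussianReal 0 V)
      (f := fun i x => x + c t i) (fun i => by fun_prop)
    simp only [gaussianReal_map_add_const, zero_add] at this
    exact this
  have h2 : (Measure.pi fun _ : Fin N => Measure.pi fun _ : Fin n => gaussianReal 0 V).map
      (fun w => w + c) = Measure.pi fun t => Measure.pi fun i : Fin n => gaussianReal (c t i) V := by
    have := Measure.pi_map_pi (μ := fun _ : Fin N => Measure.pi fun _ : Fin n => gaussianReal 0 V)
      (f := fun t x => x + c t) (fun i => by fun_prop)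
      (hμ := fun i => by rw [h1]; infer_instance)
    simp only [h1] at this
    exact this
  rw [h2, pi_dens (fun _ : Fin N => Measure.pi fun _ : Fin n => gaussianReal 0 V) _ _ ?_
    (fun t => pi_dens (fun _ : Fin n => gaussianReal 0 V) _ _ ?_
      (fun i => gauss_dens (c t i) V hV))]
  · congr 1
    funext w
    simp_rw [Real.exp_sum]
    rw [ENNReal.ofReal_prod_of_nonneg (fun _ _ => by positivity)]
    refine Finset.prod_congr rfl fun t _ => ?_
    rw [ENNReal.ofReal_prod_of_nonneg (fun _ _ => by positivity)]
  · intro t; fun_prop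
  · intro i; fun_prop

theorem mean_aux (N n : ℕ) (V : ℝ≥0) (t : Fin N) (i : Fin n) :
    Integrable (fun w : Fin N → Fin n → ℝ => w t i)
      (Measure.pi fun _ : Fin N => Measure.pi fun _ : Fin n => gaussianReal 0 V) ∧
    ∫ w : Fin N → Fin n → ℝ, w t i
      ∂(Measure.pi fun _ : Fin N => Measure.pi fun _ : Fin n => gaussianReal 0 V) = 0 := by
  have h1 := (measurePreserving_eval (fun _ : Fin n => gaussianReal 0 V) i).comp
    (measurePreserving_eval (fun _ : Fin N => Measure.pi fun _ : Fin n => gaussianReal 0 V) t)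
  have h2 : Integrable (fun x : ℝ => x) (gaussianReal 0 V) :=
    (memLp_id_gaussianReal (μ := 0) (v := V) 1).integrable (by simp)
  constructor
  · exact h1.integrable_comp_of_integrable h2
  · have h3 := integral_map (μ := Measure.pi fun _ : Fin N => Measure.pi fun _ : Fin n => gaussianReal 0 V)
      h1.measurable.aemeasurable (f := fun x : ℝ => x) (by fun_prop)
    rw [h1.map_eq, integral_id_gaussianReal] at h3
    exact h3.symm

theorem meanL (N n : ℕ) (V : ℝ≥0) (c : Fin N → Fin n → ℝ) :
    Integrable (fun w : Fin N → Fin n → ℝ => ∑ t, ∑ i, (c t i * w t i - c t i ^ 2 / 2) / V)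
      (Measure.pi fun _ : Fin N => Measure.pi fun _ : Fin n => gaussianReal 0 V) ∧
    ∫ w : Fin N → Fin n → ℝ, ∑ t, ∑ i, (c t i * w t i - c t i ^ 2 / 2) / (V : ℝ)
      ∂(Measure.pi fun _ : Fin N => Measure.pi fun _ : Fin n => gaussianReal 0 V)
      = - ∑ t, ∑ i, c t i ^ 2 / (2 * V) := by
  have hi : ∀ t i, Integrable (fun w : Fin N → Fin n → ℝ => (c t i * w t i - c t i ^ 2 / 2) / V)
      (Measure.pi fun _ : Fin N => Measure.pi fun _ : Fin n => gaussianReal 0 V) := by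
    intro t i
    exact (((mean_aux N n V t i).1.const_mul _).sub (integrable_const _)).div_const _
  constructor
  · exact integrable_finsetSum _ fun t _ => integrable_finsetSum _ fun i _ => hi t i
  · rw [integral_finsetSum _ fun t _ => integrable_finsetSum _ fun i _ => hi t i,
      ← Finset.sum_neg_distrib]
    refine Finset.sum_congr rfl fun t _ => ?_
    rw [integral_finsetSum _ fun i _ => hi t i, ← Finset.sum_neg_distrib]
    refine Finset.sum_congr rfl fun i _ => ?_
    rw [integral_div, integral_sub ((mean_aux N n V t i).1.const_mul _) (integrable_const _),
      integral_const_mul, (mean_aux N n V t i).2]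
    simp
    ring

theorem kl_aux {Ω : Type*} [MeasurableSpace Ω] (μ ν : Measure Ω) [IsProbabilityMeasure μ]
    [IsProbabilityMeasure ν] (L : Ω → ℝ) (hLm : Measurable L) (hL : Integrable L μ) (D : ℝ)
    (hD : ∫ x, L x ∂μ = - D)
    (hν : ν = μ.withDensity (fun x => ENNReal.ofReal (Real.exp (L x))))
    (F : Set Ω) (hF : MeasurableSet F) (δ : ℝ) (hδ0 : 0 < δ) (hδ : δ < 1 / 2)
    (h1 : 1 - δ ≤ μ.real F) (h2 : ν.real F ≤ δ) :
    Real.log (1 / (3 * δ)) ≤ D := by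
  classical
  set ℓ := Real.log ((1 - δ) / δ) with hℓ
  have hδ1 : 0 < 1 - δ := by linarith
  have hexpI : Integrable (fun x => Real.exp (L x)) μ := by
    refine ⟨by fun_prop, ?_⟩
    rw [hasFiniteIntegral_iff_ofReal (by filter_upwards with x; positivity)]
    have : ν Set.univ = ∫⁻ x, ENNReal.ofReal (Real.exp (L x)) ∂μ := by
      rw [hν, withDensity_apply _ MeasurableSet.univ]; simp
    rw [← this]; simp
  have hset : ∀ S, MeasurableSet S → ν.real S = ∫ x in S, Real.exp (L x) ∂μ := by
    intro S hS
    rw [integral_eq_lintegral_of_nonneg_ae (by filter_upwards with x; positivity) (by fun_prop),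
      Measure.real, hν, withDensity_apply _ hS]
  have hLint : ∫ x in F, L x ∂μ + ∫ x in Fᶜ, L x ∂μ = - D := by
    rw [integral_add_compl hF hL, hD]
  have key : ∀ S, MeasurableSet S → ∀ g : ℝ,
      (1 - g) * μ.real S + ∫ x in S, L x ∂μ ≤ Real.exp (-g) * ν.real S := by
    intro S hS g
    rw [hset S hS, ← integral_const_mul]
    have : (1 - g) * μ.real S + ∫ x in S, L x ∂μ = ∫ x in S, ((1 - g) + L x) ∂μ := by
      rw [integral_add (integrable_const _) hL.integrableOn]
      simp [mul_comm]
    rw [this]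
    apply integral_mono ((integrable_const _).add hL.integrableOn)
      (hexpI.integrableOn.const_mul _)
    intro x
    have := Real.add_one_le_exp (L x - g)
    simp only [← Real.exp_add]
    rw [show -g + L x = L x - g by ring]
    simp only [Pi.add_apply]
    linarith
  have k1 := key F hF (-ℓ)
  have k2 := key Fᶜ hF.compl ℓ
  rw [probReal_compl_eq_one_sub hF, probReal_compl_eq_one_sub hF] at k2
  have e1 : Real.exp ℓ = (1 - δ) / δ := Real.exp_log (by positivity)
  have e2 : Real.exp (-ℓ) = δ / (1 - δ) := by rw [Real.exp_neg, e1, inv_div]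
  rw [neg_neg, e1] at k1
  rw [e2] at k2
  set p := μ.real F
  set q := ν.real F
  have hℓ0 : 0 ≤ ℓ := Real.log_nonneg (by rw [le_div_iff₀ hδ0]; linarith)
  have e3 : (1 - δ) / δ * q + δ / (1 - δ) * (1 - q) ≤ 1 := by
    have hc : δ / (1 - δ) ≤ 1 := by rw [div_le_one hδ1]; linarith
    have hc' : 1 ≤ (1 - δ) / δ := by rw [le_div_iff₀ hδ0]; linarith
    have : (1 - δ) / δ * δ + δ / (1 - δ) * (1 - δ) = 1 := by field_simp; ring
    nlinarith
  have e4 : (1 - 2 * δ) * ℓ ≤ D := by nlinarith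
  refine le_trans ?_ e4
  -- Jensen
  have hl : ℓ = Real.log (1 - δ) - Real.log δ := Real.log_div hδ1.ne' hδ0.ne'
  have hr : Real.log (1 / (3 * δ)) = - Real.log 3 - Real.log δ := by
    rw [one_div, Real.log_inv, Real.log_mul (by norm_num) hδ0.ne']; ring
  have j1 : Real.log (1 / (3 * (1 - δ))) ≤ 1 / (3 * (1 - δ)) - 1 :=
    Real.log_le_sub_one_of_pos (by positivity)
  have j2 : Real.log (1 / (3 * δ)) ≤ 1 / (3 * δ) - 1 :=
    Real.log_le_sub_one_of_pos (by positivity)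
  have hr' : Real.log (1 / (3 * (1 - δ))) = - Real.log 3 - Real.log (1 - δ) := by
    rw [one_div, Real.log_inv, Real.log_mul (by norm_num) hδ1.ne']; ring
  rw [hr] at j2 ⊢
  rw [hr'] at j1
  rw [hl]
  have j3 : (1 - 2 * δ) * (1 / (3 * (1 - δ)) - 1) + 2 * δ * (1 / (3 * δ) - 1) ≤ 0 := by
    have a1 : 2 * δ * (1 / (3 * δ) - 1) = 2 / 3 - 2 * δ := by field_simp
    have a2 : (1 - 2 * δ) / (3 * (1 - δ)) ≤ 1 / 3 := by
      rw [div_le_div_iff₀ (by positivity) (by norm_num)]; linarith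
    have a3 : (1 - 2 * δ) * (1 / (3 * (1 - δ)) - 1) = (1 - 2 * δ) / (3 * (1 - δ)) - (1 - 2 * δ) := by
      field_simp
    linarith
  nlinarith [mul_le_mul_of_nonneg_left j1 (by linarith : 0 ≤ 1 - 2 * δ),
    mul_le_mul_of_nonneg_left j2 (by linarith : 0 ≤ 2 * δ)]

theorem prob_aux (N n : ℕ) (V : ℝ≥0) : IsProbabilityMeasure
    (Measure.pi fun _ : Fin N => Measure.pi fun _ : Fin n => gaussianReal 0 V) := inferInstance

theorem traj_measurable {n : ℕ} (N : ℕ) (A : Matrix (Fin n) (Fin n) ℝ) (B : Fin n → ℝ)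
    (u : ℕ → ℝ) : Measurable (trajMap N A B u) := by
  have h : ∀ s : ℕ, Measurable (fun w : Fin N → Fin n → ℝ =>
      traj A B u (fun s => if h : s < N then w ⟨s, h⟩ else 0) s) := by
    intro s
    induction s with
    | zero => exact measurable_const
    | succ s ih =>
      simp only [traj]
      refine Measurable.add (Measurable.add ?_ measurable_const) ?_
      · exact (Continuous.matrix_mulVec continuous_const continuous_id).measurable.comp ih
      · by_cases hs : s < N
        · simp only [hs, dite_true]
          exact measurable_pi_apply _
        · simp only [hs, dite_false]
          exact measurable_const
  exact measurable_pi_lambda _ fun t => h _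

theorem traj_shift {n : ℕ} (N : ℕ) (A : Matrix (Fin n) (Fin n) ℝ) (v m : ℝ)
    (u : ℕ → ℝ) (w : Fin N → Fin n → ℝ) :
    trajMap N A (vecB n v m) u w = trajMap N A (vecB n v 0) u
      (w + fun (t : Fin N) (i : Fin n) => if (i : ℕ) = 0 then u t * m else 0) := by
  have h : ∀ s : ℕ, s ≤ N →
      traj A (vecB n v m) u (fun s => if h : s < N then w ⟨s, h⟩ else 0) s =
      traj A (vecB n v 0) u (fun s => if h : s < N then
        (w + fun (t : Fin N) (i : Fin n) => if (i : ℕ) = 0 then u t * m else 0 : Fin N → Fin n → ℝ) ⟨s, h⟩ else 0) s := by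
    intro s
    induction s with
    | zero => intro _; rfl
    | succ s ih =>
      intro hs
      have hs' : s < N := hs
      simp only [traj, hs', dite_true]
      rw [ih hs'.le]
      funext i
      simp only [Pi.add_apply, Pi.smul_apply, smul_eq_mul, vecB]
      by_cases hi : (i : ℕ) = 0
      · simp only [hi, if_true]; ring
      · simp only [hi, if_false]; ring
  funext t
  exact h _ t.2

theorem stmt16 (n : ℕ) (hn : 2 ≤ n) (r v : ℝ) (hr : 1 < r) (hv0 : 0 < v)
    (hv : v < (r - 1) / 2) (N : ℕ) (hN : 1 ≤ N) (σw σu : ℝ) (hσw : 0 < σw)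
    (hσu : 0 < σu) (u : ℕ → ℝ) (hu : ∀ t < N, u t ^ 2 ≤ σu ^ 2)
    (π : (Fin N → Fin n → ℝ) → Fin n → ℝ) (hπ : Measurable π)
    (δ : ℝ) (hδ0 : 0 < δ) (hδ : δ < 1 / 2)
    (h₁ : ENNReal.ofReal (1 - δ) ≤
      ((Measure.pi fun _ : Fin N =>
          Measure.pi fun _ : Fin n => gaussianReal 0 ⟨σw ^ 2, sq_nonneg σw⟩).map
        (trajMap N (matA n r v) (vecB n v 0) u))
        {x | IsStable (matA n r v + Matrix.vecMulVec (vecB n v 0) (π x))})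
    (h₂ : ENNReal.ofReal (1 - δ) ≤
      ((Measure.pi fun _ : Fin N =>
          Measure.pi fun _ : Fin n => gaussianReal 0 ⟨σw ^ 2, sq_nonneg σw⟩).map
        (trajMap N (matA n r v) (vecB n v (2 * (2 * v / (r - 1)) ^ n)) u))
        {x | IsStable (matA n r v +
          Matrix.vecMulVec (vecB n v (2 * (2 * v / (r - 1)) ^ n)) (π x))}) :
    (N : ℝ) ≥ σw ^ 2 / (2 * σu ^ 2) * ((r - 1) / (2 * v)) ^ (2 * n) *
      Real.log (1 / (3 * δ)) := by
  obtain ⟨C, hC, hC1, hC2⟩ := disj_aux n hn r v hr hv0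
  generalize hm : 2 * (2 * v / (r - 1)) ^ n = m at h₂ hC2
  generalize hV : (⟨σw ^ 2, sq_nonneg σw⟩ : ℝ≥0) = V at h₁ h₂
  have hVr : (V : ℝ) = σw ^ 2 := by rw [← hV]
  have hV0 : V ≠ 0 := by
    intro h
    rw [h] at hVr
    have : 0 < σw ^ 2 := by positivity
    simp at hVr
    linarith
  have : IsProbabilityMeasure
      (Measure.pi fun _ : Fin N => Measure.pi fun _ : Fin n => gaussianReal 0 V) := prob_aux N n V
  set μ := Measure.pi fun _ : Fin N => Measure.pi fun _ : Fin n => gaussianReal 0 V with hμ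
  set T := trajMap N (matA n r v) (vecB n v 0) u with hT
  have hTm : Measurable T := traj_measurable _ _ _ _
  set c : Fin N → Fin n → ℝ := fun t i => if (i : ℕ) = 0 then u t * m else 0 with hc
  set ν := μ.map (fun w => w + c) with hν
  have hsm : Measurable (fun w : Fin N → Fin n → ℝ => w + c) := by fun_prop
  have : IsProbabilityMeasure ν := Measure.isProbabilityMeasure_map hsm.aemeasurable
  set F := T ⁻¹' (π ⁻¹' C) with hF
  have hFm : MeasurableSet F := hTm (hπ hC)
  have hmap : μ.map (trajMap N (matA n r v) (vecB n v m) u) = ν.map T := by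
    rw [hν, Measure.map_map hTm hsm]
    congr 1
    funext w
    exact traj_shift N _ v m u w
  have g1 : 1 - δ ≤ μ.real F := by
    have : ENNReal.ofReal (1 - δ) ≤ μ F := by
      refine h₁.trans ?_
      rw [hF, ← Measure.map_apply hTm (hπ hC)]
      exact measure_mono fun x hx => hC1 _ hx
    exact (ENNReal.ofReal_le_iff_le_toReal (measure_ne_top _ _)).1 this
  have g2 : ν.real F ≤ δ := by
    have : ENNReal.ofReal (1 - δ) ≤ ν Fᶜ := by
      refine h₂.trans ?_
      rw [hmap, hF, ← Set.preimage_compl, ← Set.preimage_compl,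
        ← Measure.map_apply hTm (hπ hC.compl)]
      exact measure_mono fun x hx => hC2 _ hx
    have h3 : 1 - δ ≤ ν.real Fᶜ := (ENNReal.ofReal_le_iff_le_toReal (measure_ne_top _ _)).1 this
    rw [probReal_compl_eq_one_sub hFm] at h3
    linarith
  have hkl := kl_aux μ ν _ (by fun_prop) (meanL N n V c).1 _ (meanL N n V c).2
    (shift_dens N n V hV0 c) F hFm δ hδ0 hδ g1 g2
  have hin : ∀ t : Fin N, ∑ i, c t i ^ 2 / (2 * V) ≤ σu ^ 2 * m ^ 2 / (2 * σw ^ 2) := by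
    intro t
    rw [Finset.sum_eq_single (⟨0, by omega⟩ : Fin n)]
    · simp only [hc, if_true, hVr, mul_pow]
      have := hu t t.2
      gcongr
    · intro b _ hb
      have : (b : ℕ) ≠ 0 := fun h => hb (Fin.ext h)
      simp [hc, this]
    · simp
  have hD : Real.log (1 / (3 * δ)) ≤ N * (σu ^ 2 * m ^ 2 / (2 * σw ^ 2)) := by
    refine hkl.trans ((Finset.sum_le_sum fun t _ => hin t).trans ?_)
    simp
  have hr' : 0 < r - 1 := by linarith
  have hq : ((r - 1) / (2 * v)) ^ (2 * n) * m ^ 2 = 4 := by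
    rw [← hm, mul_pow, ← pow_mul, mul_comm n 2, mul_left_comm, ← mul_pow]
    have : (r - 1) / (2 * v) * (2 * v / (r - 1)) = 1 := by field_simp
    rw [this]; norm_num
  calc σw ^ 2 / (2 * σu ^ 2) * ((r - 1) / (2 * v)) ^ (2 * n) * Real.log (1 / (3 * δ))
      ≤ σw ^ 2 / (2 * σu ^ 2) * ((r - 1) / (2 * v)) ^ (2 * n) *
        (N * (σu ^ 2 * m ^ 2 / (2 * σw ^ 2))) := by gcongr
    _ = (((r - 1) / (2 * v)) ^ (2 * n) * m ^ 2) * (N / 4) := by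
        field_simp; ring
    _ = N := by rw [hq]; ring
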